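/- Let d ≥ 1 and let Σ be a finite nonempty subset of GL_d(ℤ) such that no matrix of Σ has its inverse also in Σ, and suppose the subgroup H = ⟨Σ⟩ generated by Σ is infinite. Then there exists a constant C > 0 such that for every n ≥ 2 and every matrix h over ℤ/q(n)ℤ, the number of words w of length n over the alphabet Σ̃ = Σ ∪ Σ⁻¹ whose product M(w) reduces modulo q(n) to h is at most C · |Σ̃|ⁿ / (log n)². In particular, for any choice of a target matrix h_n over ℤ/q(n)ℤ for each n, the probability that a uniformly random length-n word w over Σ̃ satisfies M(w) ≡ h_n (mod q(n)) is O((log n)⁻²). -/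

import Mathlib

open Matrix

/-- `q n` is the product of all primes `p ≤ (log₂ n)^5` (and `q 0 = q 1 = 1`). -/
noncomputable def qfun (n : ℕ) : ℕ :=
  ∏ p ∈ Finset.filter Nat.Prime (Finset.range (⌊(Real.logb 2 n) ^ 5⌋₊ + 1)), p

section RandomWalk

open scoped Pointwise

variable {G ι : Type*} [Group G] [Fintype ι]

/-- The Markov operator of the random walk on `G` with uniformly chosen steps `a i`. -/
noncomputable def walkAverage (a : ι → G) (f : G → ℝ) (x : G) : ℝ :=
  (∑ i, f (a i * x)) / Fintype.card ι

lemma walkAverage_nonneg (a : ι → G) {f : G → ℝ} (hf : ∀ x, 0 ≤ f x) (x : G) :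
    0 ≤ walkAverage a f x :=
  div_nonneg (Finset.sum_nonneg fun _ _ => hf _) (Nat.cast_nonneg _)

lemma sum_word_prod_mul (a : ι → G) [Nonempty ι] (n : ℕ) (f : G → ℝ) (x : G) :
    ∑ w : Fin n → ι, f ((List.ofFn fun i => a (w i)).prod * x) =
      (Fintype.card ι : ℝ) ^ n * (walkAverage a)^[n] f x := by
  have hN : (Fintype.card ι : ℝ) ≠ 0 := Nat.cast_ne_zero.2 Fintype.card_ne_zero
  induction n generalizing f with
  | zero => simp
  | succ n ih =>
    rw [← (Fin.consEquiv fun _ => ι).sum_comp, Fintype.sum_prod_type_right,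
      Function.iterate_succ_apply, pow_succ, mul_right_comm, ← ih, Finset.sum_mul]
    refine Finset.sum_congr rfl fun w _ => ?_
    rw [walkAverage, div_mul_cancel₀ _ hN]
    simp [Fin.consEquiv, mul_assoc]

variable [Fintype G]

lemma sum_comp_mul_left (f : G → ℝ) (g : G) : ∑ x, f (g * x) = ∑ x, f x :=
  Equiv.sum_comp (Equiv.mulLeft g) f

lemma sum_walkAverage [Nonempty ι] (a : ι → G) (f : G → ℝ) :
    ∑ x, walkAverage a f x = ∑ x, f x := by
  have hN : (Fintype.card ι : ℝ) ≠ 0 := Nat.cast_ne_zero.2 Fintype.card_ne_zero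
  simp_rw [walkAverage]
  rw [← Finset.sum_div, Finset.sum_comm]
  simp [sum_comp_mul_left, hN]

/-- The operator is self-adjoint when the step distribution is symmetric. -/
lemma sum_mul_walkAverage (a : ι → G) (σ : Equiv.Perm ι) (hσ : ∀ i, a (σ i) = (a i)⁻¹)
    (f g : G → ℝ) : ∑ x, f x * walkAverage a g x = ∑ x, walkAverage a f x * g x := by
  simp_rw [walkAverage, mul_div_assoc', div_mul_eq_mul_div]
  rw [← Finset.sum_div, ← Finset.sum_div]
  congr 1
  simp_rw [Finset.mul_sum, Finset.sum_mul]
  rw [Finset.sum_comm, Finset.sum_comm (f := fun x i => f (a i * x) * g x), ← Equiv.sum_comp σ]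
  refine Finset.sum_congr rfl fun i _ => ?_
  rw [← sum_comp_mul_left _ (a i)]
  simp [hσ]

lemma sum_iterate_walkAverage_mul (a : ι → G) (σ : Equiv.Perm ι) (hσ : ∀ i, a (σ i) = (a i)⁻¹)
    (k : ℕ) (f g : G → ℝ) :
    ∑ x, f x * (walkAverage a)^[k] g x = ∑ x, (walkAverage a)^[k] f x * g x := by
  induction k generalizing g with
  | zero => rfl
  | succ k ih =>
    rw [Function.iterate_succ_apply, ih, sum_mul_walkAverage a σ hσ,
      Function.iterate_succ_apply']

/-- The loss of energy in one step is a sum of squared differences. -/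
lemma sum_sq_sub_sum_sq_walkAverage [Nonempty ι] (a : ι → G) (f : G → ℝ) :
    2 * (Fintype.card ι : ℝ) ^ 2 * (∑ x, f x ^ 2 - ∑ x, walkAverage a f x ^ 2) =
      ∑ i, ∑ j, ∑ x, (f x - f (a i * (a j)⁻¹ * x)) ^ 2 := by
  have hN : (Fintype.card ι : ℝ) ≠ 0 := Nat.cast_ne_zero.2 Fintype.card_ne_zero
  have shift (i j : ι) : ∑ x, (f x - f (a i * (a j)⁻¹ * x)) ^ 2 =
      2 * ∑ x, f x ^ 2 - 2 * ∑ x, f (a i * x) * f (a j * x) := by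
    rw [← sum_comp_mul_left _ (a j)]
    have h (g : G) : ∑ x, f (g * x) ^ 2 = ∑ x, f x ^ 2 := sum_comp_mul_left (fun x => f x ^ 2) g
    have h' : ∀ x, (f (a j * x) - f (a i * (a j)⁻¹ * (a j * x))) ^ 2 =
        f (a j * x) ^ 2 + f (a i * x) ^ 2 - 2 * (f (a i * x) * f (a j * x)) := by
      intro x
      rw [show a i * (a j)⁻¹ * (a j * x) = a i * x by group]
      ring
    simp_rw [h', Finset.sum_sub_distrib, Finset.sum_add_distrib, h, ← Finset.mul_sum]
    ring
  have hsq : (Fintype.card ι : ℝ) ^ 2 * ∑ x, walkAverage a f x ^ 2 =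
      ∑ i, ∑ j, ∑ x, f (a i * x) * f (a j * x) := by
    have h1 : ∀ x, (Fintype.card ι : ℝ) ^ 2 * walkAverage a f x ^ 2 =
        ∑ i, ∑ j, f (a i * x) * f (a j * x) := by
      intro x
      rw [← Finset.sum_mul_sum, walkAverage]
      field_simp
    rw [Finset.mul_sum, Finset.sum_congr rfl fun x _ => h1 x, Finset.sum_comm]
    exact Finset.sum_congr rfl fun i _ => Finset.sum_comm
  simp_rw [shift, Finset.sum_sub_distrib, ← Finset.mul_sum]
  rw [← hsq]
  simp
  ring

/-- A translate by a product of `R` elements of `T` differs from `f` by at most `R` times the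
largest difference caused by one element of `T`. -/
lemma sum_sq_sub_translate_le {T : Set G} {f : G → ℝ} {D : ℝ}
    (hT : ∀ t ∈ T, ∑ x, (f x - f (t * x)) ^ 2 ≤ D) (R : ℕ) :
    ∀ g ∈ T ^ R, ∑ x, (f x - f (g * x)) ^ 2 ≤ (R : ℝ) ^ 2 * D := by
  induction R with
  | zero => simp
  | succ R ih =>
    rw [pow_succ]
    rintro _ ⟨g, hg, t, ht, rfl⟩
    rcases Nat.eq_zero_or_pos R with rfl | hR
    · simp only [pow_zero, Set.mem_one] at hg
      simpa [hg] using hT t ht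
    have hR' : (0 : ℝ) < R := Nat.cast_pos.2 hR
    have key (x : G) : R * (f x - f (g * t * x)) ^ 2 ≤
        (R + 1) * ((f x - f (t * x)) ^ 2 * R + (f (t * x) - f (g * (t * x))) ^ 2) := by
      rw [mul_assoc]
      nlinarith [sq_nonneg (R * (f x - f (t * x)) - (f (t * x) - f (g * (t * x))))]
    have hsum := Finset.sum_le_sum fun x (_ : x ∈ Finset.univ) => key x
    rw [← Finset.mul_sum, ← Finset.mul_sum, Finset.sum_add_distrib, ← Finset.sum_mul,
      sum_comp_mul_left (fun x => (f x - f (g * x)) ^ 2) t] at hsum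
    have h1 := ih g hg
    have h2 := mul_le_mul_of_nonneg_right (hT t ht) hR'.le
    refine le_of_mul_le_mul_left (hsum.trans ?_) hR'
    push_cast
    calc _ ≤ ((R : ℝ) + 1) * (D * R + R ^ 2 * D) := by gcongr
      _ = _ := by ring

/-- A function of total mass one whose translates by many elements are close to it is spread
out. -/
lemma card_mul_sum_sq_le {f : G → ℝ} (hf : ∀ x, 0 ≤ f x) (hsum : ∑ x, f x = 1) {A : Finset G}
    {E : ℝ} (hA : ∀ g ∈ A, ∑ x, (f x - f (g * x)) ^ 2 ≤ E) :
    (A.card : ℝ) * ∑ x, f x ^ 2 ≤ 1 + A.card * E / 2 := by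
  have h1 (g : G) : ∑ x, f x ^ 2 =
      ∑ x, f x * f (g * x) + (∑ x, (f x - f (g * x)) ^ 2) / 2 := by
    have h : ∑ x, f (g * x) ^ 2 = ∑ x, f x ^ 2 := sum_comp_mul_left (fun x => f x ^ 2) g
    have h' : ∑ x, (f x - f (g * x)) ^ 2 =
        ∑ x, f x ^ 2 + ∑ x, f (g * x) ^ 2 - 2 * ∑ x, f x * f (g * x) := by
      rw [Finset.mul_sum, ← Finset.sum_add_distrib, ← Finset.sum_sub_distrib]
      exact Finset.sum_congr rfl fun x _ => by ring
    rw [h', h]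
    ring
  have h2 : ∑ g ∈ A, ∑ x, f x * f (g * x) ≤ 1 := by
    rw [Finset.sum_comm, ← hsum]
    refine Finset.sum_le_sum fun x _ => ?_
    rw [← Finset.mul_sum]
    refine mul_le_of_le_one_right (hf x) ?_
    calc ∑ g ∈ A, f (g * x) ≤ ∑ g, f (g * x) :=
          Finset.sum_le_sum_of_subset_of_nonneg (Finset.subset_univ _) fun _ _ _ => hf _
      _ = 1 := by rw [← hsum]; exact Equiv.sum_comp (Equiv.mulRight x) f
  calc (A.card : ℝ) * ∑ x, f x ^ 2 = ∑ g ∈ A, ∑ x, f x ^ 2 := by simp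
    _ = ∑ g ∈ A, ∑ x, f x * f (g * x) + (∑ g ∈ A, ∑ x, (f x - f (g * x)) ^ 2) / 2 := by
        rw [Finset.sum_div, ← Finset.sum_add_distrib]
        exact Finset.sum_congr rfl fun g _ => h1 g
    _ ≤ 1 + A.card * E / 2 := by
        have := Finset.sum_le_card_nsmul A _ E hA
        rw [nsmul_eq_mul] at this
        linarith

lemma sum_sq_le_add_loss [Nonempty ι] (a : ι → G) {R : ℕ} {A : Finset G}
    (hA : ∀ g ∈ A, g ∈ (Set.range fun p : ι × ι => a p.1 * (a p.2)⁻¹) ^ R)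
    (hcard : R + 1 ≤ A.card) {f : G → ℝ} (hf : ∀ x, 0 ≤ f x) (hsum : ∑ x, f x = 1) :
    ∑ x, f x ^ 2 ≤ 1 / (R + 1) + (R : ℝ) ^ 2 * (Fintype.card ι : ℝ) ^ 2 *
      (∑ x, f x ^ 2 - ∑ x, walkAverage a f x ^ 2) := by
  set D := ∑ i, ∑ j, ∑ x, (f x - f (a i * (a j)⁻¹ * x)) ^ 2 with hDdef
  have hloss : _ = D := sum_sq_sub_sum_sq_walkAverage a f
  have hT : ∀ t ∈ Set.range fun p : ι × ι => a p.1 * (a p.2)⁻¹,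
      ∑ x, (f x - f (t * x)) ^ 2 ≤ D := by
    rintro _ ⟨⟨i, j⟩, rfl⟩
    have hnn (i j : ι) : 0 ≤ ∑ x, (f x - f (a i * (a j)⁻¹ * x)) ^ 2 := by positivity
    exact (Finset.single_le_sum (fun j _ => hnn i j) (Finset.mem_univ j)).trans
      (Finset.single_le_sum (f := fun i => ∑ j, ∑ x, (f x - f (a i * (a j)⁻¹ * x)) ^ 2)
        (fun i _ => Finset.sum_nonneg fun j _ => hnn i j) (Finset.mem_univ i))
  have h1 := card_mul_sum_sq_le hf hsum fun g hg =>
    sum_sq_sub_translate_le hT R g (hA g hg)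
  have hV : ((R : ℝ) + 1) ≤ A.card := by exact_mod_cast hcard
  have hR : (0 : ℝ) < R + 1 := by positivity
  have hV0 : (0 : ℝ) < A.card := hR.trans_le hV
  have h2 : ∑ x, f x ^ 2 ≤ 1 / A.card + R ^ 2 * D / 2 := by
    refine le_of_mul_le_mul_left (h1.trans_eq ?_) hV0
    field_simp
  have h3 : 1 / (A.card : ℝ) ≤ 1 / (R + 1) := one_div_le_one_div_of_le hR hV
  calc _ ≤ _ := h2
    _ ≤ 1 / (R + 1) + R ^ 2 * D / 2 := by gcongr
    _ = _ := by rw [← hloss]; ring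

lemma sum_sq_walkAverage_le [Nonempty ι] (a : ι → G) (f : G → ℝ) :
    ∑ x, walkAverage a f x ^ 2 ≤ ∑ x, f x ^ 2 := by
  have hN : (0 : ℝ) < Fintype.card ι := Nat.cast_pos.2 Fintype.card_pos
  have h := sum_sq_sub_sum_sq_walkAverage a f
  have h0 : 0 ≤ 2 * (Fintype.card ι : ℝ) ^ 2 *
      (∑ x, f x ^ 2 - ∑ x, walkAverage a f x ^ 2) := by rw [h]; positivity
  exact sub_nonneg.1 (nonneg_of_mul_nonneg_right h0 (by positivity))

/-- Linear growth up to radius `R` forces the collision probability down to order `1 / R`. -/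
lemma sum_sq_iterate_walkAverage_le [Nonempty ι] (a : ι → G) {R K : ℕ} {A : Finset G}
    (hA : ∀ g ∈ A, g ∈ (Set.range fun p : ι × ι => a p.1 * (a p.2)⁻¹) ^ R)
    (hcard : R + 1 ≤ A.card) (hK : Fintype.card ι ^ 2 * (R + 1) ^ 3 ≤ K)
    {f : G → ℝ} (hf : ∀ x, 0 ≤ f x) (hsum : ∑ x, f x = 1) :
    ∑ x, (walkAverage a)^[K] f x ^ 2 ≤ 2 / (R + 1) := by
  have hN : (0 : ℝ) < Fintype.card ι := Nat.cast_pos.2 Fintype.card_pos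
  have hR : (0 : ℝ) < R + 1 := by positivity
  have hprob (k : ℕ) : (∀ x, 0 ≤ (walkAverage a)^[k] f x) ∧
      ∑ x, (walkAverage a)^[k] f x = 1 := by
    induction k with
    | zero => exact ⟨hf, hsum⟩
    | succ k ih =>
      rw [Function.iterate_succ_apply']
      exact ⟨walkAverage_nonneg a ih.1, (sum_walkAverage a _).trans ih.2⟩
  have h0 : ∑ x, f x ^ 2 ≤ 1 := by
    rw [← hsum]
    refine Finset.sum_le_sum fun x _ => ?_
    have : f x ≤ 1 := by
      rw [← hsum]
      exact Finset.single_le_sum (fun y _ => hf y) (Finset.mem_univ x)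
    nlinarith [hf x]
  have main (k : ℕ) : ∑ x, (walkAverage a)^[k] f x ^ 2 ≤ 2 / (R + 1) ∨
      ∑ x, (walkAverage a)^[k] f x ^ 2 ≤
        1 - k / ((Fintype.card ι : ℝ) ^ 2 * ((R : ℝ) + 1) ^ 3) := by
    induction k with
    | zero => right; simpa using h0
    | succ k ih =>
      have hmono := sum_sq_walkAverage_le a ((walkAverage a)^[k] f)
      have hle := sum_sq_le_add_loss a hA hcard (hprob k).1 (hprob k).2
      rw [Function.iterate_succ_apply']
      by_cases hsmall : ∑ x, (walkAverage a)^[k] f x ^ 2 ≤ 2 / (R + 1)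
      · exact Or.inl (hmono.trans hsmall)
      right
      have ih := ih.resolve_left hsmall
      push Not at hsmall
      set u := ∑ x, (walkAverage a)^[k] f x ^ 2
      set v := ∑ x, walkAverage a ((walkAverage a)^[k] f) x ^ 2
      have hRR : (R : ℝ) ^ 2 * (Fintype.card ι : ℝ) ^ 2 * (u - v) ≤
          (R + 1) ^ 2 * (Fintype.card ι : ℝ) ^ 2 * (u - v) := by
        have : 0 ≤ u - v := sub_nonneg.2 hmono
        gcongr
        linarith
      have h2 : (2 : ℝ) / (R + 1) = 1 / (R + 1) + 1 / (R + 1) := by ring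
      have hdrop : 1 / ((R : ℝ) + 1) ≤ (R + 1) ^ 2 * (Fintype.card ι : ℝ) ^ 2 * (u - v) := by
        linarith
      have hdrop' : 1 / ((Fintype.card ι : ℝ) ^ 2 * ((R : ℝ) + 1) ^ 3) ≤ u - v := by
        rw [div_le_iff₀ (by positivity)] at hdrop ⊢
        linarith
      push_cast
      rw [add_div]
      linarith
  refine (main K).elim id fun h => h.trans (le_trans ?_ (by positivity))
  rw [sub_nonpos, one_le_div (by positivity)]
  exact_mod_cast hK

lemma iterate_walkAverage_single_le [DecidableEq G] [Nonempty ι] (a : ι → G)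
    (σ : Equiv.Perm ι) (hσ : ∀ i, a (σ i) = (a i)⁻¹) {R n : ℕ} {A : Finset G}
    (hA : ∀ g ∈ A, g ∈ (Set.range fun p : ι × ι => a p.1 * (a p.2)⁻¹) ^ R)
    (hcard : R + 1 ≤ A.card) (hn : 2 * (Fintype.card ι ^ 2 * (R + 1) ^ 3) ≤ n) (g y : G) :
    (walkAverage a)^[n] (Pi.single g 1) y ≤ 2 / (R + 1) := by
  have hN : (0 : ℝ) < Fintype.card ι := Nat.cast_pos.2 Fintype.card_pos
  have heven (K : ℕ) (hK : Fintype.card ι ^ 2 * (R + 1) ^ 3 ≤ K) (y : G) :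
      (walkAverage a)^[K + K] (Pi.single g 1) y ≤ 2 / (R + 1) := by
    have hsq (z : G) : ∑ x, (walkAverage a)^[K] (Pi.single z 1) x ^ 2 ≤ 2 / (R + 1) :=
      sum_sq_iterate_walkAverage_le a hA hcard hK
        (fun x => by by_cases h : x = z <;> simp [h]) (by simp)
    have hval : (walkAverage a)^[K + K] (Pi.single g 1) y =
        ∑ x, (walkAverage a)^[K] (Pi.single y 1) x * (walkAverage a)^[K] (Pi.single g 1) x := by
      rw [← sum_iterate_walkAverage_mul a σ hσ, ← Function.iterate_add_apply]
      simp [Pi.single_apply]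
    rw [hval]
    calc _ ≤ ∑ x, ((walkAverage a)^[K] (Pi.single y 1) x ^ 2 +
          (walkAverage a)^[K] (Pi.single g 1) x ^ 2) / 2 :=
          Finset.sum_le_sum fun x _ => by
            linarith [two_mul_le_add_sq ((walkAverage a)^[K] (Pi.single y 1) x)
              ((walkAverage a)^[K] (Pi.single g 1) x)]
      _ ≤ _ := by
          rw [← Finset.sum_div, Finset.sum_add_distrib]
          linarith [hsq y, hsq g]
  rcases Nat.even_or_odd' n with ⟨K, rfl | rfl⟩
  · rw [two_mul]
    exact heven K (by lia) y
  · rw [Function.iterate_succ_apply', two_mul, walkAverage, div_le_iff₀ hN]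
    calc _ ≤ ∑ _i : ι, (2 : ℝ) / (R + 1) := Finset.sum_le_sum fun i _ => heven K (by lia) _
      _ = _ := by simp; ring

/-- The number of words of length `n` with a prescribed product. -/
lemma card_word_prod_eq_le [Nonempty ι] (a : ι → G)
    (σ : Equiv.Perm ι) (hσ : ∀ i, a (σ i) = (a i)⁻¹) {R n : ℕ} {A : Finset G}
    (hA : ∀ g ∈ A, g ∈ (Set.range fun p : ι × ι => a p.1 * (a p.2)⁻¹) ^ R)
    (hcard : R + 1 ≤ A.card) (hn : 2 * (Fintype.card ι ^ 2 * (R + 1) ^ 3) ≤ n) (g : G) :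
    (Nat.card {w : Fin n → ι // (List.ofFn fun i => a (w i)).prod = g} : ℝ) ≤
      (Fintype.card ι : ℝ) ^ n * (2 / (R + 1)) := by
  classical
  have h := sum_word_prod_mul a n (Pi.single g 1) 1
  simp only [mul_one, Pi.single_apply, Finset.sum_boole] at h
  rw [Nat.card_eq_fintype_card, Fintype.card_subtype, h]
  gcongr
  convert iterate_walkAverage_single_le a σ hσ hA hcard hn g 1 using 2

end RandomWalk

section Growth

/-- The words of even length generate a subgroup of index at most two. -/
lemma infinite_closure_range_mul_inv {Γ ι : Type*} [Group Γ] [Nonempty ι] (b : ι → Γ)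
    (σ : ι → ι) (hσ : ∀ i, b (σ i) = (b i)⁻¹)
    (hb : (Subgroup.closure (Set.range b) : Set Γ).Infinite) :
    (Subgroup.closure (Set.range fun p : ι × ι => b p.1 * (b p.2)⁻¹) : Set Γ).Infinite := by
  intro hfin
  set E := Subgroup.closure (Set.range fun p : ι × ι => b p.1 * (b p.2)⁻¹)
  obtain ⟨s⟩ := ‹Nonempty ι›
  have hE (i j : ι) : b i * (b j)⁻¹ ∈ E := Subgroup.subset_closure ⟨(i, j), rfl⟩
  have hE' (i j : ι) : b i * b j ∈ E := by simpa [hσ] using hE i (σ j)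
  have hmem : ∀ g ∈ Subgroup.closure (Set.range b), g ∈ E ∨ g * b s ∈ E := by
    intro g hg
    induction hg using Subgroup.closure_induction_right with
    | one => exact Or.inl E.one_mem
    | mul_right x hx y hy ih =>
      obtain ⟨i, rfl⟩ := hy
      rcases ih with h | h
      · exact Or.inr (by simpa [mul_assoc] using E.mul_mem h (hE' i s))
      · left
        have := E.mul_mem h (hE' (σ s) i)
        simpa [hσ, mul_assoc] using this
    | mul_inv_cancel x hx y hy ih =>
      obtain ⟨i, rfl⟩ := hy
      rcases ih with h | h
      · right
        have := E.mul_mem h (hE' (σ i) s)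
        simpa [hσ, mul_assoc] using this
      · left
        have := E.mul_mem h (hE (σ s) i)
        simpa [hσ, mul_assoc] using this
  refine hb ((hfin.union (hfin.image fun g => g * (b s)⁻¹)).subset fun g hg => ?_)
  rcases hmem g hg with h | h
  · exact Or.inl h
  · exact Or.inr ⟨g * b s, h, by simp⟩

open scoped Pointwise

lemma exists_abs_entry_pow_le {d : ℕ} {X : Set (GL (Fin d) ℤ)} (hX : X.Finite) :
    ∃ c : ℕ, 1 ≤ c ∧ ∀ R : ℕ, ∀ g ∈ X ^ R, ∀ r s, |g r s| ≤ (c : ℤ) ^ R := by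
  obtain ⟨B, hB⟩ : ∃ B : ℕ, ∀ g ∈ X, ∀ r s, |g r s| ≤ (B : ℤ) := by
    obtain ⟨B, hB⟩ := (hX.image fun g => ∑ r, ∑ s, (g r s).natAbs).bddAbove
    refine ⟨B, fun g hg r s => ?_⟩
    have h1 : (g r s).natAbs ≤ ∑ s, (g r s).natAbs :=
      Finset.single_le_sum (f := fun s => (g r s).natAbs) (fun _ _ => Nat.zero_le _)
        (Finset.mem_univ s)
    have h2 : ∑ s, (g r s).natAbs ≤ ∑ r, ∑ s, (g r s).natAbs :=
      Finset.single_le_sum (f := fun r => ∑ s, (g r s).natAbs) (fun _ _ => Nat.zero_le _)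
        (Finset.mem_univ r)
    rw [Int.abs_eq_natAbs]
    exact_mod_cast (h1.trans h2).trans (hB ⟨g, hg, rfl⟩)
  refine ⟨d * B + 1, by lia, fun R => ?_⟩
  induction R with
  | zero =>
    intro g hg r s
    simp only [pow_zero, Set.mem_one] at hg
    subst hg
    by_cases h : r = s <;> simp [h]
  | succ R ih =>
    rw [pow_succ]
    rintro _ ⟨g, hg, t, ht, rfl⟩ r s
    have hc : (0 : ℤ) ≤ ((d * B + 1 : ℕ) : ℤ) ^ R := by positivity
    calc |(g * t) r s| = |∑ j, g r j * t j s| := by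
          simp [Matrix.mul_apply]
      _ ≤ ∑ j, |g r j * t j s| := Finset.abs_sum_le_sum_abs _ _
      _ ≤ ∑ _j : Fin d, ((d * B + 1 : ℕ) : ℤ) ^ R * B := by
          refine Finset.sum_le_sum fun j _ => ?_
          rw [abs_mul]
          exact mul_le_mul (ih g hg r j) (hB t ht j s) (abs_nonneg _) hc
      _ ≤ ((d * B + 1 : ℕ) : ℤ) ^ (R + 1) := by
          rw [Finset.sum_const, Finset.card_univ, Fintype.card_fin, nsmul_eq_mul, pow_succ]
          push_cast at hc ⊢
          nlinarith

lemma injOn_map_castRingHom {d q : ℕ} {M : ℤ} (hq : 2 * M < q) {Y : Set (GL (Fin d) ℤ)}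
    (hY : ∀ g ∈ Y, ∀ r s, |g r s| ≤ M) :
    Set.InjOn (GeneralLinearGroup.map (n := Fin d) (Int.castRingHom (ZMod q))) Y := by
  intro g hg g' hg' h
  ext r s
  have hrs : ((g r s : ℤ) : ZMod q) = (g' r s : ℤ) := by
    simpa using congrArg (fun k : GL (Fin d) (ZMod q) => k r s) h
  rw [ZMod.intCast_eq_intCast_iff_dvd_sub] at hrs
  refine (sub_eq_zero.1 (Int.eq_zero_of_abs_lt_dvd hrs ?_)).symm
  have h1 := abs_le.1 (hY g hg r s)
  have h2 := abs_le.1 (hY g' hg' r s)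
  rw [abs_lt]
  constructor <;> linarith

end Growth

section Asymptotics

open Filter Asymptotics

lemma qfun_eq_primorial (n : ℕ) : qfun n = primorial ⌊(Real.logb 2 n) ^ 5⌋₊ := rfl

lemma eventually_div_four_le_theta : ∀ᶠ x : ℝ in atTop, x / 4 ≤ Chebyshev.theta x := by
  have h := (isLittleO_log_rpow_atTop (r := 1 / 2) (by norm_num)).bound
    (show (0 : ℝ) < 1 / 20 by norm_num)
  filter_upwards [h, eventually_ge_atTop 3] with x hx hx3
  have h0 : (0 : ℝ) ≤ x := by linarith
  have hlog : 0 ≤ Real.log x := Real.log_nonneg (by linarith)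
  rw [← Real.sqrt_eq_rpow, Real.norm_of_nonneg hlog, Real.norm_of_nonneg (Real.sqrt_nonneg x)]
    at hx
  have hs : √x * √x = x := Real.mul_self_sqrt h0
  have hs1 : 1 ≤ √x := Real.one_le_sqrt.2 (by linarith)
  have h1 : √x * Real.log x ≤ x / 20 := by nlinarith
  have h2 : Real.log (x + 2) ≤ 2 * Real.log x := by
    rw [← Real.log_rpow (by linarith)]
    exact Real.log_le_log (by linarith) (by norm_num; nlinarith)
  have h3 := Chebyshev.theta_ge' (show 1 ≤ x by linarith)
  have h4 := Real.log_two_gt_d9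
  nlinarith

lemma eventually_two_mul_pow_lt_qfun {c : ℕ} (hc : 1 ≤ c) :
    ∀ᶠ n : ℕ in atTop, 2 * c ^ ⌊(Real.logb 2 n) ^ 2⌋₊ < qfun n := by
  have hL : Tendsto (fun n : ℕ => Real.logb 2 n) atTop atTop :=
    (Real.tendsto_logb_atTop one_lt_two).comp tendsto_natCast_atTop_atTop
  have hθ := ((tendsto_pow_atTop (n := 5) (by norm_num)).comp hL).eventually
    eventually_div_four_le_theta
  filter_upwards [hθ, hL.eventually_ge_atTop (4 * Real.log c + 5)] with n h1 h2
  have hc' : (1 : ℝ) ≤ c := by exact_mod_cast hc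
  have hlc : 0 ≤ Real.log c := Real.log_nonneg hc'
  simp only [Function.comp_apply] at h1
  rw [Chebyshev.theta_eq_log_primorial, ← qfun_eq_primorial] at h1
  set L := Real.logb 2 n
  have hq : 0 < qfun n := by rw [qfun_eq_primorial]; exact primorial_pos _
  rw [← Nat.cast_lt (α := ℝ)]
  refine (Real.log_lt_log_iff (by positivity) (by positivity)).1 (lt_of_lt_of_le ?_ h1)
  push_cast
  rw [Real.log_mul (by norm_num) (by positivity), Real.log_pow]
  have h3 : (⌊L ^ 2⌋₊ : ℝ) ≤ L ^ 2 := Nat.floor_le (by positivity)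
  have h4 : (⌊L ^ 2⌋₊ : ℝ) * Real.log c ≤ L ^ 2 * Real.log c := by gcongr
  have h5 := Real.log_two_lt_d9
  have hL5 : 5 ≤ L := by linarith
  have h6 : L ^ 2 * (4 * Real.log c + 4) < L ^ 2 * L := by gcongr; linarith
  have h7 : L ^ 3 ≤ L ^ 5 := pow_le_pow_right₀ (by linarith) (by norm_num)
  nlinarith

lemma eventually_mul_floor_pow_le (N : ℕ) :
    ∀ᶠ n : ℕ in atTop, 2 * (N ^ 2 * (⌊(Real.logb 2 n) ^ 2⌋₊ + 1) ^ 3) ≤ n := by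
  have hL : Tendsto (fun n : ℕ => Real.logb 2 n) atTop atTop :=
    (Real.tendsto_logb_atTop one_lt_two).comp tendsto_natCast_atTop_atTop
  have hl2 : 0 < Real.log 2 := Real.log_pos one_lt_two
  have hε : 0 < (Real.log 2) ^ 6 / (16 * ((N : ℝ) ^ 2 + 1)) := by positivity
  have h := tendsto_natCast_atTop_atTop.eventually
    ((Real.isLittleO_pow_log_id_atTop (n := 6)).bound hε)
  filter_upwards [h, hL.eventually_ge_atTop 1] with n h1 h2
  rw [Real.norm_of_nonneg (by positivity), id, Real.norm_of_nonneg (by positivity),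
    div_mul_eq_mul_div, le_div_iff₀ (by positivity)] at h1
  have hlog : Real.log n = Real.logb 2 n * Real.log 2 := by
    rw [Real.logb, div_mul_cancel₀ _ hl2.ne']
  rw [hlog, mul_pow] at h1
  set L := Real.logb 2 n
  have h3 : (⌊L ^ 2⌋₊ : ℝ) ≤ L ^ 2 := Nat.floor_le (by positivity)
  have h4 : (⌊L ^ 2⌋₊ : ℝ) + 1 ≤ 2 * L ^ 2 := by nlinarith
  rw [← Nat.cast_le (α := ℝ)]
  push_cast
  have h5 : L ^ 6 * (16 * ((N : ℝ) ^ 2 + 1)) ≤ n := by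
    refine le_of_mul_le_mul_left ?_ (show 0 < Real.log 2 ^ 6 by positivity)
    linarith
  calc 2 * ((N : ℝ) ^ 2 * ((⌊L ^ 2⌋₊ : ℝ) + 1) ^ 3) ≤ 2 * ((N : ℝ) ^ 2 * (2 * L ^ 2) ^ 3) := by
        gcongr
    _ = L ^ 6 * (16 * (N : ℝ) ^ 2) := by ring
    _ ≤ L ^ 6 * (16 * ((N : ℝ) ^ 2 + 1)) := by gcongr; linarith
    _ ≤ n := h5

end Asymptotics

section MatrixWords

open scoped Pointwise

/-- Words of length `n` over a finite symmetric alphabet generating an infinite group of integer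
matrices rarely have a prescribed product modulo `q`, once `q` separates a ball. -/
lemma card_word_prod_map_eq_le {d : ℕ} {ι : Type*} [Fintype ι] [Nonempty ι]
    (b : ι → GL (Fin d) ℤ) (σ : Equiv.Perm ι) (hσ : ∀ i, b (σ i) = (b i)⁻¹)
    (hb : (Subgroup.closure (Set.range b) : Set (GL (Fin d) ℤ)).Infinite) :
    ∃ c : ℕ, 1 ≤ c ∧ ∀ n R q : ℕ, 2 * c ^ R < q →
      2 * (Fintype.card ι ^ 2 * (R + 1) ^ 3) ≤ n → ∀ h : Matrix (Fin d) (Fin d) (ZMod q),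
      (Nat.card {w : Fin n → ι //
          ((List.ofFn fun i => ((b (w i) : GL (Fin d) ℤ) : Matrix (Fin d) (Fin d) ℤ)).prod).map
            (Int.cast : ℤ → ZMod q) = h} : ℝ) ≤
        (Fintype.card ι : ℝ) ^ n * (2 / (R + 1)) := by
  classical
  set X : Finset (GL (Fin d) ℤ) :=
    Finset.univ.image fun p : ι × ι => b p.1 * (b p.2)⁻¹ with hX
  have hXcoe : (X : Set (GL (Fin d) ℤ)) = Set.range fun p : ι × ι => b p.1 * (b p.2)⁻¹ := by
    simp [hX]
  have hX1 : 1 ∈ X := by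
    obtain ⟨i⟩ := ‹Nonempty ι›
    exact Finset.mem_image.2 ⟨(i, i), Finset.mem_univ _, mul_inv_cancel _⟩
  have hgrowth := Finset.add_one_le_card_pow hX1
    (by rw [hXcoe]; exact infinite_closure_range_mul_inv b σ hσ hb)
  obtain ⟨c, hc, hentry⟩ := exists_abs_entry_pow_le X.finite_toSet
  refine ⟨c, hc, fun n R q hq hn h => ?_⟩
  have : NeZero q := ⟨by lia⟩
  have : Fintype (GL (Fin d) (ZMod q)) := Fintype.ofFinite _
  set φ := GeneralLinearGroup.map (n := Fin d) (Int.castRingHom (ZMod q))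
  have hinj : Set.InjOn φ (X ^ R : Finset (GL (Fin d) ℤ)) :=
    injOn_map_castRingHom (M := (c : ℤ) ^ R) (by exact_mod_cast hq) fun g hg =>
      hentry R g (by exact_mod_cast hg)
  have hcoe (w : Fin n → ι) :
      ((List.ofFn fun i => ((b (w i) : GL (Fin d) ℤ) : Matrix (Fin d) (Fin d) ℤ)).prod).map
        (Int.cast : ℤ → ZMod q) =
      ((List.ofFn fun i => φ (b (w i))).prod : GL (Fin d) (ZMod q)) := by
    have h1 : (List.ofFn fun i => φ (b (w i))).prod = φ (List.ofFn fun i => b (w i)).prod := by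
      rw [map_list_prod, List.map_ofFn]
      rfl
    have h2 : (List.ofFn fun i => ((b (w i) : GL (Fin d) ℤ) : Matrix (Fin d) (Fin d) ℤ)).prod =
        ((List.ofFn fun i => b (w i)).prod : GL (Fin d) ℤ) := by
      rw [← Units.coeHom_apply, map_list_prod, List.map_ofFn]
      rfl
    rw [h1, h2]
    rfl
  simp_rw [hcoe]
  by_cases hex : ∃ g : GL (Fin d) (ZMod q), (g : Matrix (Fin d) (Fin d) (ZMod q)) = h
  · obtain ⟨g, rfl⟩ := hex
    simp_rw [Units.val_inj]
    refine card_word_prod_eq_le (fun i => φ (b i)) σ (fun i => by simp [hσ])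
      (A := (X ^ R).image φ) (fun g hg => ?_) ?_ hn g
    · obtain ⟨y, hy, rfl⟩ := Finset.mem_image.1 hg
      have hrange : (Set.range fun p : ι × ι => φ (b p.1) * (φ (b p.2))⁻¹) =
          φ '' (X : Set (GL (Fin d) ℤ)) := by
        rw [hXcoe, ← Set.range_comp]
        simp [Function.comp_def]
      rw [hrange, ← Set.image_pow]
      exact ⟨y, by exact_mod_cast hy, rfl⟩
    · rw [Finset.card_image_of_injOn hinj]
      exact hgrowth R
  · have : IsEmpty {w : Fin n → ι // ((List.ofFn fun i => φ (b (w i))).prod :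
        Matrix (Fin d) (Fin d) (ZMod q)) = h} := ⟨fun w => hex ⟨_, w.2⟩⟩
    rw [Nat.card_of_isEmpty]
    push_cast
    positivity

end MatrixWords

/-- If `Σ` is a finite nonempty set of matrices in `GL_d(ℤ)` containing no matrix together with
its inverse, and the subgroup it generates is infinite, then there is `C > 0` such that for all
`n ≥ 2` and every matrix `h` over `ℤ/q(n)ℤ`, the number of words of length `n` over
`Σ̃ = Σ ∪ Σ⁻¹` whose product reduces to `h` modulo `q n` is at most `C · |Σ̃|ⁿ / (log₂ n)²`. -/
theorem wp_target_mod_q_rare (d : ℕ) (hd : 1 ≤ d) (S : Finset (GL (Fin d) ℤ))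
    (hne : S.Nonempty) (hinv : ∀ A ∈ S, A⁻¹ ∉ S)
    (hH : Infinite (Subgroup.closure (S : Set (GL (Fin d) ℤ)))) :
    ∃ C : ℝ, 0 < C ∧ ∀ n : ℕ, 2 ≤ n →
      ∀ h : Matrix (Fin d) (Fin d) (ZMod (qfun n)),
      (Nat.card {w : Fin n → {A : GL (Fin d) ℤ // A ∈ S ∨ A⁻¹ ∈ S} //
          ((List.ofFn fun i => ((w i : GL (Fin d) ℤ) : Matrix (Fin d) (Fin d) ℤ)).prod).map
            (Int.cast : ℤ → ZMod (qfun n)) = h} : ℝ)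
        ≤ C * (Nat.card {A : GL (Fin d) ℤ // A ∈ S ∨ A⁻¹ ∈ S} : ℝ) ^ n
            / (Real.logb 2 n) ^ 2 := by
  have hfin : Finite {A : GL (Fin d) ℤ // A ∈ S ∨ A⁻¹ ∈ S} :=
    (S.finite_toSet.union S.finite_toSet.inv).to_subtype
  have : Fintype {A : GL (Fin d) ℤ // A ∈ S ∨ A⁻¹ ∈ S} := Fintype.ofFinite _
  have : Nonempty {A : GL (Fin d) ℤ // A ∈ S ∨ A⁻¹ ∈ S} :=
    hne.elim fun A hA => ⟨⟨A, Or.inl hA⟩⟩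
  let σ : Equiv.Perm {A : GL (Fin d) ℤ // A ∈ S ∨ A⁻¹ ∈ S} :=
    { toFun := fun A => ⟨(A : GL (Fin d) ℤ)⁻¹, by simpa [or_comm] using A.2⟩
      invFun := fun A => ⟨(A : GL (Fin d) ℤ)⁻¹, by simpa [or_comm] using A.2⟩
      left_inv := fun A => by simp
      right_inv := fun A => by simp }
  obtain ⟨c, hc, hcount⟩ := card_word_prod_map_eq_le
    (fun A : {A : GL (Fin d) ℤ // A ∈ S ∨ A⁻¹ ∈ S} => (A : GL (Fin d) ℤ)) σ (fun _ => rfl)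
    ((Set.infinite_coe_iff.1 hH).mono <| Subgroup.closure_mono fun A hA =>
      ⟨⟨A, Or.inl hA⟩, rfl⟩)
  simp only [Nat.card_eq_fintype_card (α := {A : GL (Fin d) ℤ // A ∈ S ∨ A⁻¹ ∈ S})]
  set N := Fintype.card {A : GL (Fin d) ℤ // A ∈ S ∨ A⁻¹ ∈ S}
  obtain ⟨n₀, hn₀⟩ := Filter.eventually_atTop.1
    ((eventually_two_mul_pow_lt_qfun hc).and (eventually_mul_floor_pow_le N))
  refine ⟨2 + Real.logb 2 n₀ ^ 2, by positivity, fun n hn h => ?_⟩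
  have hL : 0 < Real.logb 2 n := Real.logb_pos one_lt_two (by exact_mod_cast hn)
  rw [le_div_iff₀ (by positivity)]
  rcases le_total n₀ n with hle | hle
  · obtain ⟨h1, h2⟩ := hn₀ n hle
    have h3 := hcount n _ _ h1 h2 h
    have h4 : Real.logb 2 n ^ 2 ≤ (⌊Real.logb 2 n ^ 2⌋₊ : ℝ) + 1 := (Nat.lt_floor_add_one _).le
    calc _ ≤ (N : ℝ) ^ n * (2 / ((⌊Real.logb 2 n ^ 2⌋₊ : ℝ) + 1)) *
          ((⌊Real.logb 2 n ^ 2⌋₊ : ℝ) + 1) := by gcongr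
      _ = 2 * (N : ℝ) ^ n := by field_simp
      _ ≤ _ := by gcongr; exact le_add_of_nonneg_right (by positivity)
  · have h1 : (Nat.card {w : Fin n → {A : GL (Fin d) ℤ // A ∈ S ∨ A⁻¹ ∈ S} //
          ((List.ofFn fun i => ((w i : GL (Fin d) ℤ) : Matrix (Fin d) (Fin d) ℤ)).prod).map
            (Int.cast : ℤ → ZMod (qfun n)) = h} : ℝ) ≤ (N : ℝ) ^ n := by
      have := Finite.card_subtype_le fun w : Fin n → {A : GL (Fin d) ℤ // A ∈ S ∨ A⁻¹ ∈ S} =>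
        ((List.ofFn fun i => ((w i : GL (Fin d) ℤ) : Matrix (Fin d) (Fin d) ℤ)).prod).map
            (Int.cast : ℤ → ZMod (qfun n)) = h
      rw [Nat.card_fun, Nat.card_fin,
        Nat.card_eq_fintype_card (α := {A : GL (Fin d) ℤ // A ∈ S ∨ A⁻¹ ∈ S})] at this
      exact_mod_cast this
    have h2 : Real.logb 2 n ≤ Real.logb 2 n₀ :=
      Real.logb_le_logb_of_le one_lt_two (by positivity) (by exact_mod_cast hle)
    calc _ ≤ (N : ℝ) ^ n * Real.logb 2 n₀ ^ 2 := by gcongr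
      _ ≤ _ := by
        rw [mul_comm]
        gcongr
        exact le_add_of_nonneg_left (by norm_num)
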